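/- Let ζ : [0,∞) → ℝ be Borel measurable and bounded on compact intervals, let β ∈ ℝ, and let Q : [0,∞) → ℝ be Borel measurable, bounded on compact intervals, and satisfy Q(t) = ζ(t) + ∫_{[0,t]} ζ(t−u) dν(u) − βt − ∫_{[0,t]} Q⁻(t−u) dν(u) for all t ≥ 0. Then Q(t) = ζ(t) − βF_e(t) + ∫_{[0,t]} Q⁺(t−s) dμ(s) for all t ≥ 0. -/

import Mathlib

open MeasureTheory Set

/-- Convolution of two Borel measures on `ℝ` (pushforward of the product under addition). -/
noncomputable def convMeas (μ ν : Measure ℝ) : Measure ℝ :=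
  Measure.map (fun p : ℝ × ℝ => p.1 + p.2) (μ.prod ν)

/-- `n`-fold convolution power of a measure on `ℝ` (the `0`-th power is `δ₀`). -/
noncomputable def convPow (μ : Measure ℝ) : ℕ → Measure ℝ
  | 0 => Measure.dirac 0
  | n + 1 => convMeas (convPow μ n) μ

/-- The renewal measure `ν = Σ_{n≥1} μ^{*n}`. -/
noncomputable def renewalMeasure (μ : Measure ℝ) : Measure ℝ :=
  Measure.sum (fun n : ℕ => convPow μ (n + 1))

lemma convMeas_eq_conv (μ ν : Measure ℝ) : convMeas μ ν = Measure.conv μ ν := rfl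

instance isProbabilityMeasure_convPow (μ : Measure ℝ) [IsProbabilityMeasure μ] (n : ℕ) :
    IsProbabilityMeasure (convPow μ n) := by
  induction n with
  | zero => exact Measure.dirac.isProbabilityMeasure
  | succ n ih =>
    rw [convPow, convMeas_eq_conv]
    infer_instance

instance sFinite_renewalMeasure (μ : Measure ℝ) [IsProbabilityMeasure μ] :
    SFinite (renewalMeasure μ) := by
  rw [renewalMeasure]
  infer_instance

lemma ae_nonneg_convPow {μ : Measure ℝ} [IsProbabilityMeasure μ] (h : ∀ᵐ x ∂μ, 0 ≤ x) (n : ℕ) :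
    ∀ᵐ x ∂(convPow μ n), 0 ≤ x := by
  induction n with
  | zero =>
    rw [convPow, ae_dirac_iff measurableSet_Ici]
  | succ n ih =>
    rw [convPow, convMeas, ae_map_iff (by fun_prop) measurableSet_Ici]
    filter_upwards [Measure.quasiMeasurePreserving_fst.ae ih,
      Measure.quasiMeasurePreserving_snd.ae h] with p h₁ h₂
    exact add_nonneg h₁ h₂

lemma ae_nonneg_renewalMeasure {μ : Measure ℝ} [IsProbabilityMeasure μ]
    (h : ∀ᵐ x ∂μ, 0 ≤ x) : ∀ᵐ x ∂(renewalMeasure μ), 0 ≤ x := by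
  rw [renewalMeasure, Measure.ae_sum_iff]
  exact fun n => ae_nonneg_convPow h (n + 1)

/-- The renewal equation for the renewal measure. -/
lemma renewalMeasure_eq_add_conv (μ : Measure ℝ) [IsProbabilityMeasure μ] :
    renewalMeasure μ = μ + Measure.conv μ (renewalMeasure μ) := by
  have h : Measure.conv (renewalMeasure μ) μ = Measure.sum fun n => convPow μ (n + 2) := by
    rw [renewalMeasure, Measure.conv, Measure.prod_sum_left, Measure.map_sum (by fun_prop)]
    rfl
  have h₁ : convPow μ 1 = μ := by
    rw [convPow, convPow, convMeas_eq_conv, Measure.dirac_zero_conv]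
  rw [Measure.conv_comm, h]
  ext s hs
  rw [renewalMeasure, Measure.add_apply, Measure.sum_apply _ hs, Measure.sum_apply _ hs,
    tsum_eq_zero_add' ENNReal.summable, zero_add, h₁]

lemma setIntegral_Icc_sub_eq_integral_indicator {m : Measure ℝ} (hm : ∀ᵐ x ∂m, 0 ≤ x)
    (f : ℝ → ℝ) (t : ℝ) :
    ∫ u in Icc 0 t, f (t - u) ∂m = ∫ u, (Ici 0).indicator f (t - u) ∂m := by
  rw [← integral_indicator measurableSet_Icc]
  refine integral_congr_ae ?_
  filter_upwards [hm] with u hu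
  simp [indicator, hu]

lemma integrable_indicator_sub {m : Measure ℝ} (hm : ∀ᵐ x ∂m, 0 ≤ x) {f : ℝ → ℝ}
    (hf : Measurable f) {t : ℝ} (hfin : m (Icc 0 t) < ⊤)
    (hb : ∃ C, ∀ x ∈ Icc 0 t, |f x| ≤ C) :
    Integrable (fun u => (Ici 0).indicator f (t - u)) m := by
  obtain ⟨C, hC⟩ := hb
  have h : IntegrableOn (fun u => f (t - u)) (Icc 0 t) m := by
    refine IntegrableOn.of_bound hfin
      (hf.comp (measurable_const.sub measurable_id)).aestronglyMeasurable C ?_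
    filter_upwards [ae_restrict_mem measurableSet_Icc] with u hu
    exact hC _ ⟨sub_nonneg.2 hu.2, sub_le_self _ hu.1⟩
  refine (h.integrable_indicator measurableSet_Icc).congr ?_
  filter_upwards [hm] with u hu
  simp [indicator, hu]

/-- Integrating `t - s` over `[0, t]` amounts to integrating the distribution function. -/
lemma setIntegral_Icc_sub_eq_intervalIntegral (μ : Measure ℝ) [IsFiniteMeasure μ] {t : ℝ}
    (ht : 0 ≤ t) :
    ∫ s in Icc 0 t, (t - s) ∂μ = ∫ u in (0 : ℝ)..t, μ.real (Icc 0 u) := by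
  let S : Set (ℝ × ℝ) := {p | p.1 ≤ p.2}
  have hS : MeasurableSet S := measurableSet_le measurable_fst measurable_snd
  have hint : Integrable (Function.uncurry fun s u : ℝ => S.indicator (fun _ => (1 : ℝ)) (s, u))
      ((μ.restrict (Icc 0 t)).prod (volume.restrict (Icc 0 t))) :=
    (integrable_const (1 : ℝ)).indicator hS
  have hswap := integral_integral_swap hint
  rw [intervalIntegral.integral_of_le ht, ← integral_Icc_eq_integral_Ioc]
  convert hswap using 1
  · refine setIntegral_congr_fun measurableSet_Icc fun s hs => ?_
    have : (fun u : ℝ => S.indicator (fun _ => (1 : ℝ)) (s, u))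
        = (Ici s).indicator fun _ => (1 : ℝ) := by
      ext u
      simp [S, indicator]
    simp only [this]
    rw [integral_indicator_const _ measurableSet_Ici, measureReal_restrict_apply measurableSet_Ici,
      show Ici s ∩ Icc 0 t = Icc s t by
        ext u
        exact ⟨fun h => ⟨h.1, h.2.2⟩, fun h => ⟨h.1, hs.1.trans h.1, h.2⟩⟩]
    simp [hs.2]
  · refine setIntegral_congr_fun measurableSet_Icc fun u hu => ?_
    have : (fun s : ℝ => S.indicator (fun _ => (1 : ℝ)) (s, u))
        = (Iic u).indicator fun _ => (1 : ℝ) := by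
      ext s
      simp [S, indicator]
    simp only [this]
    rw [integral_indicator_const _ measurableSet_Iic, measureReal_restrict_apply measurableSet_Iic,
      show Iic u ∩ Icc 0 t = Icc 0 u by
        ext s
        exact ⟨fun h => ⟨h.2.1, h.1⟩, fun h => ⟨h.2, h.1, h.2.trans hu.2⟩⟩]
    simp

/-- Integrating the renewal equation `ν = μ + μ ∗ ν` against `h (t - ·)`. -/
lemma setIntegral_renewalMeasure {μ : Measure ℝ} [IsProbabilityMeasure μ]
    (hμ : ∀ᵐ x ∂μ, 0 ≤ x) {h : ℝ → ℝ} (hm : Measurable h) {t : ℝ}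
    (hb : ∃ C, ∀ x ∈ Icc 0 t, |h x| ≤ C) (hfin : renewalMeasure μ (Icc 0 t) < ⊤) :
    IntegrableOn (fun s => h (t - s)) (Icc 0 t) μ ∧
    IntegrableOn (fun s => ∫ u in Icc 0 (t - s), h (t - s - u) ∂(renewalMeasure μ))
      (Icc 0 t) μ ∧
    ∫ u in Icc 0 t, h (t - u) ∂(renewalMeasure μ)
      = (∫ s in Icc 0 t, h (t - s) ∂μ)
        + ∫ s in Icc 0 t, ∫ u in Icc 0 (t - s), h (t - s - u) ∂(renewalMeasure μ) ∂μ := by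
  have hν := ae_nonneg_renewalMeasure hμ
  set ν := renewalMeasure μ with hνdef
  have hren : ν = μ + Measure.conv μ ν := renewalMeasure_eq_add_conv μ
  have hsub : ∀ s u : ℝ, t - (s + u) = t - s - u := fun s u => by ring
  have hi := integrable_indicator_sub hν hm hfin hb
  have hiμ := integrable_indicator_sub hμ hm (measure_lt_top μ _) hb
  have hic : Integrable (fun u => (Ici 0).indicator h (t - u)) (Measure.conv μ ν) := by
    rw [hren] at hi
    exact hi.right_of_add_measure
  have hdouble : Integrable (fun s => ∫ u, (Ici 0).indicator h (t - s - u) ∂ν) μ := by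
    have := ((integrable_map_measure hic.aestronglyMeasurable (by fun_prop)).1
      hic).integral_prod_left
    simpa only [Function.comp_def, hsub] using this
  have hzero : ∀ᵐ s ∂μ, s ∉ Icc 0 t → ∫ u, (Ici 0).indicator h (t - s - u) ∂ν = 0 := by
    filter_upwards [hμ] with s hs hst
    rw [← setIntegral_Icc_sub_eq_integral_indicator hν, Icc_eq_empty, Measure.restrict_empty,
      integral_zero_measure]
    exact fun hle => hst ⟨hs, sub_nonneg.1 hle⟩
  refine ⟨?_, ?_, ?_⟩
  · refine hiμ.integrableOn.congr_fun (fun s hs => ?_) measurableSet_Icc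
    exact indicator_of_mem (sub_nonneg.2 hs.2 : t - s ∈ Ici 0) h
  · simp only [setIntegral_Icc_sub_eq_integral_indicator hν]
    exact hdouble.integrableOn
  · simp only [setIntegral_Icc_sub_eq_integral_indicator hν]
    rw [setIntegral_Icc_sub_eq_integral_indicator hμ,
      setIntegral_eq_integral_of_ae_compl_eq_zero hzero]
    conv_lhs => rw [hren]
    rw [integral_add_measure hiμ hic, integral_conv hic]
    simp only [hsub]

/-- Corollary 5.2 (converse direction): a solution of the renewal-function
representation
`Q(t) = ζ(t) + ∫_{[0,t]} ζ(t-u) dν(u) - βt - ∫_{[0,t]} Q⁻(t-u) dν(u)`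
also satisfies the stochastic convolution equation
`Q(t) = ζ(t) - βF_e(t) + ∫_{[0,t]} Q⁺(t-s) dμ(s)`. -/
theorem stmt_9
    (μ : Measure ℝ) [IsProbabilityMeasure μ] (hμsupp : μ (Iio (0 : ℝ)) = 0)
    (hmean : ∫ u in Ici (0 : ℝ), u ∂μ = 1)
    (h0 : μ {(0 : ℝ)} < 1)
    (F G Fe : ℝ → ℝ)
    (hF : ∀ t, F t = (μ (Icc (0 : ℝ) t)).toReal)
    (hG : ∀ t, G t = 1 - F t)
    (hFe : ∀ t, Fe t = ∫ u in (0 : ℝ)..t, G u)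
    (ν : Measure ℝ) (hν : ν = renewalMeasure μ)
    (hνfin : ∀ t, 0 ≤ t → ν (Icc (0 : ℝ) t) < ⊤)
    (ζ : ℝ → ℝ) (hζm : Measurable ζ)
    (hζb : ∀ T, 0 ≤ T → ∃ C, ∀ t ∈ Icc (0 : ℝ) T, |ζ t| ≤ C)
    (β : ℝ)
    (Q : ℝ → ℝ) (hQm : Measurable Q)
    (hQb : ∀ T, 0 ≤ T → ∃ C, ∀ t ∈ Icc (0 : ℝ) T, |Q t| ≤ C)
    (hQeq : ∀ t, 0 ≤ t →
      Q t = ζ t + (∫ u in Icc (0 : ℝ) t, ζ (t - u) ∂ν) - β * t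
        - ∫ u in Icc (0 : ℝ) t, min (Q (t - u)) 0 ∂ν) :
    ∀ t, 0 ≤ t →
      Q t = ζ t - β * Fe t + ∫ s in Icc (0 : ℝ) t, max (Q (t - s)) 0 ∂μ := by
  intro t ht
  subst hν
  have hμ : ∀ᵐ x ∂μ, 0 ≤ x := by
    rw [ae_iff]
    simpa only [not_le] using! hμsupp
  let h : ℝ → ℝ := fun x => ζ x - min (Q x) 0
  have hm : Measurable h := by fun_prop
  have hminb : ∀ T, 0 ≤ T → ∃ C, ∀ x ∈ Icc 0 T, |min (Q x) 0| ≤ C := fun T hT =>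
    (hQb T hT).imp fun C hC x hx => by
      refine le_trans ?_ (hC x hx)
      rw [abs_of_nonpos (min_le_right _ _)]
      rcases min_cases (Q x) 0 with hx' | hx' <;> rw [hx'.1]
      · exact neg_le_abs _
      · simp
  have hb : ∃ C, ∀ x ∈ Icc 0 t, |h x| ≤ C := by
    obtain ⟨C, hC⟩ := hζb t ht
    obtain ⟨D, hD⟩ := hminb t ht
    exact ⟨C + D, fun x hx => (abs_sub _ _).trans (add_le_add (hC x hx) (hD x hx))⟩
  have hQrep : ∀ x, 0 ≤ x →
      Q x = ζ x + (∫ u in Icc 0 x, h (x - u) ∂(renewalMeasure μ)) - β * x := by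
    intro x hx
    have hν := ae_nonneg_renewalMeasure hμ
    have hon : ∀ {f : ℝ → ℝ}, Measurable f → (∃ C, ∀ y ∈ Icc 0 x, |f y| ≤ C) →
        IntegrableOn (fun u => f (x - u)) (Icc 0 x) (renewalMeasure μ) := fun {f} hf hfb =>
      (integrable_indicator_sub hν hf (hνfin x hx) hfb).integrableOn.congr_fun
        (fun u hu => indicator_of_mem (sub_nonneg.2 hu.2 : x - u ∈ Ici 0) f) measurableSet_Icc
    have hsub : ∫ u in Icc 0 x, h (x - u) ∂(renewalMeasure μ) = _ :=
      integral_sub (hon hζm (hζb x hx)) (hon (hQm.min measurable_const) (hminb x hx))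
    rw [hsub, hQeq x hx]
    ring
  obtain ⟨hint₁, hint₂, hren⟩ := setIntegral_renewalMeasure hμ hm hb (hνfin t ht)
  have hlin : IntegrableOn (fun s => β * (t - s)) (Icc 0 t) μ :=
    (by fun_prop : Continuous fun s => β * (t - s)).continuousOn.integrableOn_Icc
  have hpos : ∫ s in Icc 0 t, max (Q (t - s)) 0 ∂μ
      = (∫ u in Icc 0 t, h (t - u) ∂(renewalMeasure μ)) - β * ∫ s in Icc 0 t, (t - s) ∂μ := by
    rw [hren, ← integral_add hint₁ hint₂, ← integral_const_mul]
    refine Eq.trans ?_ (integral_sub (hint₁.add hint₂) hlin)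
    refine setIntegral_congr_fun measurableSet_Icc fun s hs => ?_
    have h₁ := hQrep (t - s) (sub_nonneg.2 hs.2)
    have h₂ := min_add_max (Q (t - s)) 0
    simp only [h] at h₁ ⊢
    linarith
  have hFe' : Fe t = t - ∫ s in Icc 0 t, (t - s) ∂μ := by
    have hmono : Monotone fun u => μ.real (Icc 0 u) := fun a b hab =>
      measureReal_mono (Icc_subset_Icc_right hab)
    rw [hFe, setIntegral_Icc_sub_eq_intervalIntegral μ ht]
    simp only [hG, hF, ← measureReal_def]
    rw [intervalIntegral.integral_sub intervalIntegrable_const hmono.intervalIntegrable]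
    simp
  rw [hpos, hFe', hQrep t ht]
  ring
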